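/- arXiv:2602.16067 — 2 statements merged into one kernel-verified Lean document; each statement's English description precedes it below -/
import Mathlib

section
/- Let D = Σ_j D_{L_j} be a total dissipator on M_d(ℂ). If every anti-Hermitian matrix X ∈ M_d(ℂ) (i.e. X = −X†) lies in the complex linear span of the set {L_j, L_j† : j = 1,…,m}, then D is Hamiltonian-independently contractive. -/
open scoped ComplexOrder Kronecker
open Matrix

namespace Paper

variable {n : Type*} [Fintype n] [DecidableEq n]

/-- Trace norm: sum of singular values. -/
noncomputable def traceNorm (A : Matrix n n ℂ) : ℝ :=
  ∑ i, Real.sqrt ((Matrix.posSemidef_conjTranspose_mul_self A).isHermitian.eigenvalues i)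

/-- The dissipator associated with a single jump operator. -/
noncomputable def dissipator (L x : Matrix n n ℂ) : Matrix n n ℂ :=
  L * x * Lᴴ - ((1 : ℂ)/2) • (Lᴴ * L * x + x * (Lᴴ * L))

/-- Total dissipator of a family of jump operators. -/
noncomputable def totalDissipator {m : ℕ} (L : Fin m → Matrix n n ℂ) (x : Matrix n n ℂ) :
    Matrix n n ℂ :=
  ∑ j, dissipator (L j) x

/-- The Hamiltonian commutator term `-i[H, x]`. -/
noncomputable def hamTerm (H x : Matrix n n ℂ) : Matrix n n ℂ :=
  (-Complex.I) • (H * x - x * H)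

/-- A solution of the master equation `ρ' = L_t(ρ)` starting at time `s`
(differentiable entrywise). -/
def IsSolution (Lt : ℝ → Matrix n n ℂ → Matrix n n ℂ) (s : ℝ) (ρ : ℝ → Matrix n n ℂ) : Prop :=
  ∀ t, s ≤ t → ∀ i j, HasDerivAt (fun u => ρ u i j) ((Lt t (ρ t)) i j) t

/-- Density matrix: Hermitian, positive semidefinite, trace one. -/
def IsDensity (ρ : Matrix n n ℂ) : Prop := ρ.PosSemidef ∧ ρ.trace = 1

/-- Exponential contractivity with constants `K, γ` of a time-dependent Lindbladian. -/
def ExpContractiveWith (Lt : ℝ → Matrix n n ℂ → Matrix n n ℂ) (K γ : ℝ) : Prop :=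
  ∀ s t : ℝ, 0 ≤ s → s ≤ t → ∀ ρ σ : ℝ → Matrix n n ℂ,
    IsSolution Lt s ρ → IsSolution Lt s σ → IsDensity (ρ s) → IsDensity (σ s) →
    traceNorm (ρ t - σ t) ≤ K * Real.exp (-γ * (t - s)) * traceNorm (ρ s - σ s)

/-- Exponential contractivity of a time-dependent Lindbladian. -/
def ExpContractive (Lt : ℝ → Matrix n n ℂ → Matrix n n ℂ) : Prop :=
  ∃ K γ : ℝ, 0 < K ∧ 0 < γ ∧ ExpContractiveWith Lt K γ

/-- Time-dependent Hamiltonian: Hermitian values and continuous entries. -/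
def IsHamiltonianFamily (H : ℝ → Matrix n n ℂ) : Prop :=
  (∀ t, (H t).IsHermitian) ∧ ∀ i j, Continuous fun t => H t i j

/-- Driven Lindbladian `x ↦ -i[H(t), x] + D(x)`. -/
noncomputable def driven {m : ℕ} (H : ℝ → Matrix n n ℂ) (L : Fin m → Matrix n n ℂ)
    (t : ℝ) (x : Matrix n n ℂ) : Matrix n n ℂ :=
  hamTerm (H t) x + totalDissipator L x

/-- Hamiltonian-independent contractivity of a dissipator. -/
def HamIndepContractive {m : ℕ} (L : Fin m → Matrix n n ℂ) : Prop :=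
  ∀ H : ℝ → Matrix n n ℂ, IsHamiltonianFamily H → ExpContractive (driven H L)

/-- The operator norm (largest singular value). -/
noncomputable def opNorm (A : Matrix n n ℂ) : ℝ :=
  ‖LinearMap.toContinuousLinearMap (Matrix.toEuclideanLin A)‖

end Paper

namespace Paper

lemma classical_gap {d : ℕ} (w : Fin d → Fin d → ℝ) (c : ℝ)
    (hw : ∀ i j, 0 ≤ w i j) (hwc : ∀ i j, c ≤ w i j + w j i)
    (l : Fin d → ℝ) (hl : ∑ i, l i = 0) :
    ∑ i, (SignType.sign (l i) : ℝ) * (∑ j, w i j * l j - l i * ∑ j, w j i)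
      ≤ -(c / (d + 1)) * ∑ i, |l i| := by
  set N := ∑ i, |l i| with hN
  have hN0 : 0 ≤ N := Finset.sum_nonneg fun i _ => abs_nonneg _
  set T : Fin d → Fin d → ℝ := fun i j => w i j * (|l j| - (SignType.sign (l i) : ℝ) * l j) with hT
  have habs : ∀ i, (SignType.sign (l i) : ℝ) * l i = |l i| := fun i => sign_mul_self (l i)
  have hs1 : ∀ i, |(SignType.sign (l i) : ℝ)| ≤ 1 := by
    intro i
    rcases lt_trichotomy (l i) 0 with h | h | h
    · simp [sign_neg h]
    · simp [h]
    · simp [sign_pos h]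
  have hT0 : ∀ i j, 0 ≤ T i j := by
    intro i j
    apply mul_nonneg (hw i j)
    have : (SignType.sign (l i) : ℝ) * l j ≤ |l j| := by
      calc _ ≤ |(SignType.sign (l i) : ℝ) * l j| := le_abs_self _
        _ = |(SignType.sign (l i) : ℝ)| * |l j| := abs_mul _ _
        _ ≤ 1 * |l j| := by gcongr; exact hs1 i
        _ = _ := one_mul _
    linarith
  have key : ∑ i, (SignType.sign (l i) : ℝ) * (∑ j, w i j * l j - l i * ∑ j, w j i)
      = - ∑ i, ∑ j, T i j := by
    have e1 : ∑ i, ∑ j, T i j = ∑ i, ∑ j, w j i * |l i| -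
        ∑ i, ∑ j, (SignType.sign (l i) : ℝ) * (w i j * l j) := by
      rw [Finset.sum_comm (f := fun i j => w j i * |l i|), ← Finset.sum_sub_distrib]
      refine Finset.sum_congr rfl fun i _ => ?_
      rw [← Finset.sum_sub_distrib]
      refine Finset.sum_congr rfl fun j _ => ?_
      simp only [hT]; ring
    rw [e1, neg_sub, ← Finset.sum_sub_distrib]
    refine Finset.sum_congr rfl fun i _ => ?_
    rw [← Finset.mul_sum, ← Finset.sum_mul, ← habs]; ring
  rw [key]
  rcases hN0.eq_or_lt with h0 | hpos
  · rw [← h0]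
    have := Finset.sum_nonneg fun i (_ : i ∈ Finset.univ) =>
      Finset.sum_nonneg fun j (_ : j ∈ Finset.univ) => hT0 i j
    linarith
  have hne : (Finset.univ : Finset (Fin d)).Nonempty := by
    by_contra h
    rw [Finset.not_nonempty_iff_eq_empty] at h
    rw [hN, h] at hpos; simp at hpos
  set e := N / (2 * (d + 1)) with he
  have hepos : 0 < e := by positivity
  have hsum : ∑ _i : Fin d, e ≤ N / 2 := by
    simp only [Finset.sum_const, Finset.card_univ, Fintype.card_fin, nsmul_eq_mul, he]
    rw [mul_div_assoc', div_le_div_iff₀ (by positivity) (by positivity)]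
    nlinarith
  obtain ⟨p, -, hp⟩ : ∃ p ∈ Finset.univ, e ≤ (|l p| + l p) / 2 := by
    apply Finset.exists_le_of_sum_le hne
    refine hsum.trans (le_of_eq ?_)
    rw [← Finset.sum_div, Finset.sum_add_distrib, hl, add_zero]
  obtain ⟨q, -, hq⟩ : ∃ q ∈ Finset.univ, e ≤ (|l q| - l q) / 2 := by
    apply Finset.exists_le_of_sum_le hne
    refine hsum.trans (le_of_eq ?_)
    rw [← Finset.sum_div, Finset.sum_sub_distrib, hl, sub_zero]
  have hp' : 0 < l p := by
    by_contra h
    rw [abs_of_nonpos (not_lt.1 h)] at hp; linarith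
  have hq' : l q < 0 := by
    by_contra h
    rw [abs_of_nonneg (not_lt.1 h)] at hq; linarith
  rw [abs_of_pos hp'] at hp
  rw [abs_of_neg hq'] at hq
  have hpq : p ≠ q := by rintro rfl; linarith
  have hge : T p q + T q p ≤ ∑ i, ∑ j, T i j := by
    calc T p q + T q p ≤ ∑ j, T p j + ∑ j, T q j := by
          gcongr
          · exact Finset.single_le_sum (fun j _ => hT0 p j) (Finset.mem_univ q)
          · exact Finset.single_le_sum (fun j _ => hT0 q j) (Finset.mem_univ p)
      _ = ∑ i ∈ {p, q}, ∑ j, T i j := by rw [Finset.sum_pair hpq]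
      _ ≤ _ := Finset.sum_le_sum_of_subset_of_nonneg (Finset.subset_univ _)
          fun i _ _ => Finset.sum_nonneg fun j _ => hT0 i j
  have hTpq : w p q * (2 * e) ≤ T p q := by
    simp only [hT, sign_pos hp', abs_of_neg hq']
    apply mul_le_mul_of_nonneg_left _ (hw p q)
    simp; linarith
  have hTqp : w q p * (2 * e) ≤ T q p := by
    simp only [hT, sign_neg hq', abs_of_pos hp']
    apply mul_le_mul_of_nonneg_left _ (hw q p)
    simp; linarith
  have h2e : -(c / (d + 1)) * N = - (c * (2 * e)) := by rw [he]; field_simp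
  rw [h2e]
  have := mul_le_mul_of_nonneg_right (hwc p q) (by positivity : 0 ≤ 2 * e)
  linarith

lemma exists_diag {d : ℕ} (A : Matrix (Fin d) (Fin d) ℂ) (hA : A.IsHermitian) :
    ∃ (U : Matrix (Fin d) (Fin d) ℂ) (l : Fin d → ℝ), Uᴴ * U = 1 ∧ U * Uᴴ = 1 ∧
      A = U * diagonal (fun i => (l i : ℂ)) * Uᴴ ∧ traceNorm A = ∑ i, |l i| := by
  obtain ⟨U, hU, hU', hAU⟩ : ∃ U : Matrix (Fin d) (Fin d) ℂ, Uᴴ * U = 1 ∧ U * Uᴴ = 1 ∧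
      A = U * diagonal (fun i => (hA.eigenvalues i : ℂ)) * Uᴴ := by
    refine ⟨hA.eigenvectorUnitary, ?_, ?_, ?_⟩
    · rw [← star_eq_conjTranspose]; simp
    · rw [← star_eq_conjTranspose]; simp
    · conv_lhs => rw [hA.spectral_theorem, Unitary.conjStarAlgAut_apply]
      rfl
  refine ⟨U, hA.eigenvalues, hU, hU', hAU, ?_⟩
  set l := hA.eigenvalues
  have hsq : Aᴴ * A = U * (diagonal (fun i => ((l i ^ 2 : ℝ) : ℂ)) * Uᴴ) := by
    rw [hA.eq]
    conv_lhs => rw [hAU]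
    calc _ = U * diagonal (fun i => (l i : ℂ)) * (Uᴴ * U) * diagonal (fun i => (l i : ℂ)) * Uᴴ := by
          simp only [Matrix.mul_assoc]
      _ = _ := by
          rw [hU, Matrix.mul_one, Matrix.mul_assoc U, diagonal_mul_diagonal, Matrix.mul_assoc]
          simp [pow_two]
  have hch : (Aᴴ * A).charpoly = (diagonal (fun i => ((l i ^ 2 : ℝ) : ℂ))).charpoly := by
    rw [hsq, charpoly_mul_comm, Matrix.mul_assoc, hU, Matrix.mul_one]
  have hr := (Matrix.posSemidef_conjTranspose_mul_self A).isHermitian.roots_charpoly_eq_eigenvalues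
  rw [hch, charpoly_diagonal, Polynomial.roots_prod _ _
    (Finset.prod_ne_zero_iff.2 fun i _ => Polynomial.X_sub_C_ne_zero _)] at hr
  simp only [Polynomial.roots_X_sub_C, Multiset.bind_singleton] at hr
  have := congrArg (fun m => (m.map (fun z : ℂ => Real.sqrt z.re)).sum) hr
  simp only [Multiset.map_map, Function.comp_def, Complex.ofReal_re] at this
  unfold traceNorm
  have h2 := this.symm
  simp only [Real.sqrt_sq_eq_abs] at h2
  exact h2

/-- rotated dual bound -/
lemma dual_le {d : ℕ} (A U : Matrix (Fin d) (Fin d) ℂ) (hA : A.IsHermitian)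
    (hU' : U * Uᴴ = 1) (s : Fin d → ℝ) (hs : ∀ i, |s i| ≤ 1) :
    ∑ i, s i * ((Uᴴ * A * U) i i).re ≤ traceNorm A := by
  obtain ⟨V, l, hV, hV', hAV, hN⟩ := exists_diag A hA
  rw [hN]
  set W := Vᴴ * U with hW
  have hWW : W * Wᴴ = 1 := by
    rw [hW, conjTranspose_mul, conjTranspose_conjTranspose]
    calc _ = Vᴴ * (U * Uᴴ) * V := by simp only [Matrix.mul_assoc]
      _ = _ := by rw [hU', Matrix.mul_one, hV]
  have hrow : ∀ k, ∑ i, ‖W k i‖ ^ 2 = 1 := by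
    intro k
    have := congrFun (congrFun hWW k) k
    rw [Matrix.mul_apply] at this
    simp only [conjTranspose_apply, one_apply_eq, RCLike.star_def, Complex.mul_conj,
      Complex.normSq_eq_norm_sq] at this
    exact_mod_cast this
  have hent : ∀ i, ((Uᴴ * A * U) i i).re = ∑ k, l k * ‖W k i‖ ^ 2 := by
    intro i
    have : Uᴴ * A * U = Wᴴ * (diagonal (fun i => (l i : ℂ)) * W) := by
      rw [hW, conjTranspose_mul, conjTranspose_conjTranspose, hAV]
      simp only [Matrix.mul_assoc]
    rw [this, Matrix.mul_apply, Complex.re_sum]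
    refine Finset.sum_congr rfl fun k _ => ?_
    rw [diagonal_mul, conjTranspose_apply, mul_left_comm, RCLike.star_def, Complex.conj_mul']
    norm_cast
  simp only [hent, Finset.mul_sum]
  rw [Finset.sum_comm]
  refine Finset.sum_le_sum fun k _ => ?_
  calc ∑ i, s i * (l k * ‖W k i‖ ^ 2) ≤ ∑ i, |l k| * ‖W k i‖ ^ 2 := by
        refine Finset.sum_le_sum fun i _ => ?_
        rw [← mul_assoc]
        apply mul_le_mul_of_nonneg_right _ (by positivity)
        calc _ ≤ |s i * l k| := le_abs_self _
          _ = |s i| * |l k| := abs_mul _ _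
          _ ≤ 1 * |l k| := by gcongr; exact hs i
          _ = _ := one_mul _
    _ = |l k| := by rw [← Finset.mul_sum, hrow, mul_one]

lemma gap_const {d m : ℕ} (L : Fin m → Matrix (Fin d) (Fin d) ℂ)
    (hspan : ∀ X : Matrix (Fin d) (Fin d) ℂ, Xᴴ = -X →
      X ∈ Submodule.span ℂ (Set.range L ∪ Set.range fun j => (L j)ᴴ)) :
    ∃ c : ℝ, 0 < c ∧ ∀ U : Matrix (Fin d) (Fin d) ℂ, Uᴴ * U = 1 → ∀ i j,
      c ≤ ∑ k, ‖(Uᴴ * L k * U) i j‖ ^ 2 + ∑ k, ‖(Uᴴ * L k * U) j i‖ ^ 2 := by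
  have hall : ∀ X : Matrix (Fin d) (Fin d) ℂ,
      X ∈ Submodule.span ℂ (Set.range L ∪ Set.range fun j => (L j)ᴴ) := by
    intro X
    have h1 := hspan (X - Xᴴ) (by simp)
    have h2 := hspan (Complex.I • (X + Xᴴ)) (by
      simp [conjTranspose_smul, add_comm])
    have : X = (1/2 : ℂ) • (X - Xᴴ) + (-Complex.I/2) • (Complex.I • (X + Xᴴ)) := by
      rw [smul_smul]
      have : -Complex.I / 2 * Complex.I = 1/2 := by
        rw [div_mul_eq_mul_div, neg_mul, Complex.I_mul_I]; norm_num
      rw [this, ← smul_add, sub_add_add_cancel, ← two_smul ℂ X, smul_smul]; norm_num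
    rw [this]
    exact Submodule.add_mem _ (Submodule.smul_mem _ _ h1) (Submodule.smul_mem _ _ h2)
  set Q : Matrix (Fin d) (Fin d) ℂ → Fin d → Fin d → ℝ := fun U i j =>
    ∑ k, ‖(Uᴴ * L k * U) i j‖ ^ 2 + ∑ k, ‖(Uᴴ * L k * U) j i‖ ^ 2 with hQ
  have hQ0 : ∀ U i j, 0 ≤ Q U i j := fun U i j => by positivity
  have hC : ∀ X : Matrix (Fin d) (Fin d) ℂ, ∃ C : ℝ, 0 ≤ C ∧ ∀ U : Matrix (Fin d) (Fin d) ℂ, ∀ i j,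
      ‖(Uᴴ * X * U) i j‖ ^ 2 ≤ C * Q U i j := by
    intro X
    induction hall X using Submodule.span_induction with
    | mem X hX =>
      refine ⟨1, zero_le_one, fun U i j => ?_⟩
      rw [one_mul]
      rcases hX with ⟨k, rfl⟩ | ⟨k, rfl⟩
      · have := Finset.single_le_sum (f := fun k => ‖(Uᴴ * L k * U) i j‖ ^ 2)
          (fun k _ => by positivity) (Finset.mem_univ k)
        have h2 : 0 ≤ ∑ k, ‖(Uᴴ * L k * U) j i‖ ^ 2 := by positivity
        simp only [hQ]; linarith
      · have := Finset.single_le_sum (f := fun k => ‖(Uᴴ * L k * U) j i‖ ^ 2)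
          (fun k _ => by positivity) (Finset.mem_univ k)
        have h2 : 0 ≤ ∑ k, ‖(Uᴴ * L k * U) i j‖ ^ 2 := by positivity
        have h3 : ‖(Uᴴ * (L k)ᴴ * U) i j‖ = ‖(Uᴴ * L k * U) j i‖ := by
          have : Uᴴ * (L k)ᴴ * U = (Uᴴ * L k * U)ᴴ := by
            simp [conjTranspose_mul, Matrix.mul_assoc]
          rw [this, conjTranspose_apply, norm_star]
        simp only [hQ, h3]; linarith
    | zero => exact ⟨0, le_rfl, fun U i j => by simp⟩
    | add X Y _ _ hX hY =>
      obtain ⟨C, hC, hCX⟩ := hX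
      obtain ⟨D, hD, hDY⟩ := hY
      refine ⟨2 * (C + D), by positivity, fun U i j => ?_⟩
      have h1 := hCX U i j
      have h2 := hDY U i j
      rw [Matrix.mul_add, Matrix.add_mul, Matrix.add_apply]
      have h3 := norm_add_le ((Uᴴ * X * U) i j) ((Uᴴ * Y * U) i j)
      have h4 := pow_le_pow_left₀ (norm_nonneg _) h3 2
      nlinarith [sq_nonneg (‖(Uᴴ * X * U) i j‖ - ‖(Uᴴ * Y * U) i j‖)]
    | smul a X _ hX =>
      obtain ⟨C, hC, hCX⟩ := hX
      refine ⟨‖a‖ ^ 2 * C, by positivity, fun U i j => ?_⟩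
      rw [Matrix.mul_smul, Matrix.smul_mul, Matrix.smul_apply, norm_smul, mul_pow, mul_assoc (‖a‖ ^ 2) C]
      exact mul_le_mul_of_nonneg_left (hCX U i j) (sq_nonneg ‖a‖)
  choose C hC0 hCX using hC
  set S := ∑ a, ∑ b, C (Matrix.single a b 1) with hS
  have hS0 : 0 ≤ S := Finset.sum_nonneg fun a _ => Finset.sum_nonneg fun b _ => hC0 _
  refine ⟨1 / (S + 1), by positivity, fun U hU i j => ?_⟩
  have hcol : ∀ i, ∑ a, ‖U a i‖ ^ 2 = 1 := by
    intro k
    have := congrFun (congrFun hU k) k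
    rw [Matrix.mul_apply] at this
    simp only [conjTranspose_apply, one_apply_eq, RCLike.star_def, Complex.conj_mul'] at this
    exact_mod_cast this
  have hent : ∀ a b, ‖(Uᴴ * (Matrix.single a b 1 : Matrix (Fin d) (Fin d) ℂ) * U) i j‖ ^ 2 = ‖U a i‖ ^ 2 * ‖U b j‖ ^ 2 := by
    intro a b
    have : (Uᴴ * (Matrix.single a b 1 : Matrix (Fin d) (Fin d) ℂ) * U) i j = star (U a i) * U b j := by
      simp [Matrix.mul_apply, Matrix.single_apply, ite_and]
    rw [this, norm_mul, norm_star, mul_pow]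
  have h1 : (1 : ℝ) ≤ S * Q U i j := by
    calc (1 : ℝ) = ∑ a, ∑ b, ‖(Uᴴ * (Matrix.single a b 1 : Matrix (Fin d) (Fin d) ℂ) * U) i j‖ ^ 2 := by
          simp only [hent, ← Finset.mul_sum, hcol, mul_one]
      _ ≤ ∑ a, ∑ b, C (Matrix.single a b 1) * Q U i j :=
          Finset.sum_le_sum fun a _ => Finset.sum_le_sum fun b _ => hCX _ U i j
      _ = _ := by simp only [hS, Finset.sum_mul]
  rw [div_le_iff₀ (by positivity)]
  have := hQ0 U i j
  change 1 ≤ Q U i j * (S + 1)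
  nlinarith

end Paper
namespace Paper

lemma conj_mul' {d : ℕ} (U A B : Matrix (Fin d) (Fin d) ℂ) (hU' : U * Uᴴ = 1) :
    Uᴴ * (A * B) * U = (Uᴴ * A * U) * (Uᴴ * B * U) := by
  calc _ = Uᴴ * A * 1 * B * U := by simp only [Matrix.mul_assoc, Matrix.mul_one]
    _ = _ := by rw [← hU']; simp only [Matrix.mul_assoc]

lemma conj_driven {d m : ℕ} (U : Matrix (Fin d) (Fin d) ℂ) (hU' : U * Uᴴ = 1)
    (H : ℝ → Matrix (Fin d) (Fin d) ℂ) (L : Fin m → Matrix (Fin d) (Fin d) ℂ) (t : ℝ)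
    (B : Matrix (Fin d) (Fin d) ℂ) :
    Uᴴ * driven H L t B * U =
      driven (fun t => Uᴴ * H t * U) (fun k => Uᴴ * L k * U) t (Uᴴ * B * U) := by
  have hstar : ∀ A : Matrix (Fin d) (Fin d) ℂ, (Uᴴ * A * U)ᴴ = Uᴴ * Aᴴ * U := by
    intro A; simp [conjTranspose_mul, Matrix.mul_assoc]
  simp only [driven, hamTerm, totalDissipator, dissipator, hstar, ← conj_mul' _ _ _ hU']
  simp only [Matrix.mul_add, Matrix.add_mul, Matrix.mul_sub, Matrix.sub_mul, Matrix.mul_smul,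
    Matrix.smul_mul, Matrix.mul_sum, Matrix.sum_mul]

lemma diag_driven {d m : ℕ}
    (H : ℝ → Matrix (Fin d) (Fin d) ℂ) (L : Fin m → Matrix (Fin d) (Fin d) ℂ) (t : ℝ)
    (l : Fin d → ℝ) (i : Fin d) :
    ((driven H L t (diagonal fun i => (l i : ℂ))) i i).re =
      ∑ j, (∑ k, ‖L k i j‖ ^ 2) * l j - l i * ∑ j, ∑ k, ‖L k j i‖ ^ 2 := by
  have h1 : ∀ k, (dissipator (L k) (diagonal fun i => (l i : ℂ))) i i =
      ((∑ j, ‖L k i j‖ ^ 2 * l j - l i * ∑ j, ‖L k j i‖ ^ 2 : ℝ) : ℂ) := by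
    intro k
    have e1 : (L k * (diagonal fun i => (l i : ℂ)) * (L k)ᴴ) i i
        = ((∑ j, ‖L k i j‖ ^ 2 * l j : ℝ) : ℂ) := by
      rw [Matrix.mul_apply, Complex.ofReal_sum]
      refine Finset.sum_congr rfl fun j _ => ?_
      rw [mul_diagonal, conjTranspose_apply, RCLike.star_def, mul_right_comm, Complex.mul_conj']
      push_cast; rfl
    have e2 : ((L k)ᴴ * L k) i i = ((∑ j, ‖L k j i‖ ^ 2 : ℝ) : ℂ) := by
      rw [Matrix.mul_apply, Complex.ofReal_sum]
      refine Finset.sum_congr rfl fun j _ => ?_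
      rw [conjTranspose_apply, RCLike.star_def, Complex.conj_mul']
      push_cast; rfl
    rw [dissipator, Matrix.sub_apply, Matrix.smul_apply, Matrix.add_apply, mul_diagonal,
      diagonal_mul, e1, e2]
    simp only [smul_eq_mul, Complex.ofReal_sub, Complex.ofReal_mul]
    ring
  have h0 : (hamTerm (H t) (diagonal fun i => (l i : ℂ))) i i = 0 := by
    simp [hamTerm, mul_comm]
  rw [driven, Matrix.add_apply, h0, zero_add, totalDissipator, Matrix.sum_apply]
  simp only [h1]
  rw [← Complex.ofReal_sum, Complex.ofReal_re, Finset.sum_sub_distrib, ← Finset.mul_sum]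
  congr 1
  · rw [Finset.sum_comm]; simp only [Finset.sum_mul]
  · rw [Finset.sum_comm]

lemma trace_driven {d m : ℕ}
    (H : ℝ → Matrix (Fin d) (Fin d) ℂ) (L : Fin m → Matrix (Fin d) (Fin d) ℂ) (t : ℝ)
    (x : Matrix (Fin d) (Fin d) ℂ) : (driven H L t x).trace = 0 := by
  have h1 : ∀ k, (dissipator (L k) x).trace = 0 := by
    intro k
    rw [dissipator, trace_sub, trace_smul, trace_add, trace_mul_comm x, Matrix.mul_assoc,
      trace_mul_comm, Matrix.mul_assoc x, trace_mul_comm x, smul_eq_mul]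
    ring
  rw [driven, hamTerm, totalDissipator, trace_add, trace_sum]
  simp [h1, trace_mul_comm x]

lemma driven_sub {d m : ℕ}
    (H : ℝ → Matrix (Fin d) (Fin d) ℂ) (L : Fin m → Matrix (Fin d) (Fin d) ℂ) (t : ℝ)
    (x y : Matrix (Fin d) (Fin d) ℂ) :
    driven H L t (x - y) = driven H L t x - driven H L t y := by
  have h1 : ∀ k, dissipator (L k) (x - y) = dissipator (L k) x - dissipator (L k) y := by
    intro k
    simp only [dissipator, Matrix.mul_sub, Matrix.sub_mul, smul_add, smul_sub]
    abel
  simp only [driven, hamTerm, totalDissipator, h1, Finset.sum_sub_distrib, Matrix.mul_sub,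
    Matrix.sub_mul, smul_sub]
  abel

lemma driven_smul {d m : ℕ}
    (H : ℝ → Matrix (Fin d) (Fin d) ℂ) (L : Fin m → Matrix (Fin d) (Fin d) ℂ) (t : ℝ)
    (a : ℂ) (x : Matrix (Fin d) (Fin d) ℂ) :
    driven H L t (a • x) = a • driven H L t x := by
  simp only [driven, hamTerm, totalDissipator, dissipator, Matrix.mul_smul, Matrix.smul_mul,
    smul_add, smul_sub, Finset.smul_sum, smul_comm a]

lemma driven_star {d m : ℕ}
    (H : ℝ → Matrix (Fin d) (Fin d) ℂ) (hH : ∀ t, (H t).IsHermitian)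
    (L : Fin m → Matrix (Fin d) (Fin d) ℂ) (t : ℝ)
    (x : Matrix (Fin d) (Fin d) ℂ) :
    driven H L t xᴴ = (driven H L t x)ᴴ := by
  have h1 : ∀ k, dissipator (L k) xᴴ = (dissipator (L k) x)ᴴ := by
    intro k
    simp [dissipator, conjTranspose_mul, Matrix.mul_assoc, add_comm]
  have h2 : hamTerm (H t) xᴴ = (hamTerm (H t) x)ᴴ := by
    simp only [hamTerm, conjTranspose_smul, conjTranspose_sub, conjTranspose_mul, (hH t).eq]
    simp only [RCLike.star_def, map_neg, Complex.conj_I, neg_neg, neg_smul, smul_sub]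
    abel
  simp only [driven, totalDissipator, h1, h2, conjTranspose_add, conjTranspose_sum]

end Paper
namespace Paper

lemma hasDerivAt_conj {d : ℕ} (U : Matrix (Fin d) (Fin d) ℂ) (z : ℝ → Matrix (Fin d) (Fin d) ℂ)
    (z' : Matrix (Fin d) (Fin d) ℂ) (t : ℝ)
    (hz : ∀ i j, HasDerivAt (fun u => z u i j) (z' i j) t) (s : Fin d → ℝ) :
    HasDerivAt (fun u => ∑ i, s i * ((Uᴴ * z u * U) i i).re)
      (∑ i, s i * ((Uᴴ * z' * U) i i).re) t := by
  refine HasDerivAt.fun_sum fun i _ => HasDerivAt.const_mul _ ?_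
  have h : HasDerivAt (fun u => (Uᴴ * z u * U) i i) ((Uᴴ * z' * U) i i) t := by
    simp only [Matrix.mul_apply]
    exact HasDerivAt.fun_sum fun b _ => HasDerivAt.mul_const
      (HasDerivAt.fun_sum fun a _ => HasDerivAt.const_mul _ (hz a b)) _
  exact Complex.reCLM.hasFDerivAt.comp_hasDerivAt t h

lemma sign_abs_le (x : ℝ) : |(SignType.sign x : ℝ)| ≤ 1 := by
  rcases lt_trichotomy x 0 with h | h | h
  · simp [sign_neg h]
  · simp [h]
  · simp [sign_pos h]

lemma diag_back {d : ℕ} (U A D : Matrix (Fin d) (Fin d) ℂ) (hU : Uᴴ * U = 1)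
    (hA : A = U * D * Uᴴ) : Uᴴ * A * U = D := by
  rw [hA]
  calc _ = (Uᴴ * U) * D * (Uᴴ * U) := by simp only [Matrix.mul_assoc]
    _ = _ := by rw [hU, Matrix.one_mul, Matrix.mul_one]

lemma traceNorm_sub_le {d : ℕ} (A B : Matrix (Fin d) (Fin d) ℂ) (hA : A.IsHermitian)
    (hB : B.IsHermitian) :
    traceNorm B - traceNorm A ≤ d * ∑ a, ∑ b, ‖B a b - A a b‖ := by
  obtain ⟨U, l, hU, hU', hBU, hN⟩ := exists_diag B hB
  have h1 := dual_le A U hA hU' (fun i => (SignType.sign (l i) : ℝ)) fun i => sign_abs_le _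
  have h2 : traceNorm B = ∑ i, (SignType.sign (l i) : ℝ) * ((Uᴴ * B * U) i i).re := by
    rw [diag_back U B _ hU hBU, hN]
    simp [sign_mul_self]
  have hcol : ∀ i, ∑ a, ‖U a i‖ ^ 2 = 1 := by
    intro k
    have := congrFun (congrFun hU k) k
    rw [Matrix.mul_apply] at this
    simp only [conjTranspose_apply, one_apply_eq, RCLike.star_def, Complex.conj_mul'] at this
    exact_mod_cast this
  have hle : ∀ a i, ‖U a i‖ ≤ 1 := by
    intro a i
    have := Finset.single_le_sum (f := fun a => ‖U a i‖ ^ 2) (fun a _ => sq_nonneg _)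
      (Finset.mem_univ a)
    rw [hcol] at this
    exact (sq_le_one_iff₀ (norm_nonneg _)).1 this
  have h3 : traceNorm B - traceNorm A ≤
      ∑ i, (SignType.sign (l i) : ℝ) * ((Uᴴ * (B - A) * U) i i).re := by
    have : ∑ i, (SignType.sign (l i) : ℝ) * ((Uᴴ * (B - A) * U) i i).re =
      ∑ i, (SignType.sign (l i) : ℝ) * ((Uᴴ * B * U) i i).re -
      ∑ i, (SignType.sign (l i) : ℝ) * ((Uᴴ * A * U) i i).re := by
      rw [← Finset.sum_sub_distrib]
      refine Finset.sum_congr rfl fun i _ => ?_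
      rw [Matrix.mul_sub, Matrix.sub_mul, Matrix.sub_apply, Complex.sub_re, mul_sub]
    rw [this, ← h2]; linarith
  refine h3.trans ?_
  have h4 : ∀ i, (SignType.sign (l i) : ℝ) * ((Uᴴ * (B - A) * U) i i).re ≤
      ∑ a, ∑ b, ‖B a b - A a b‖ := by
    intro i
    have h5 : ‖(Uᴴ * (B - A) * U) i i‖ ≤ ∑ b, ∑ a, ‖B a b - A a b‖ := by
      rw [Matrix.mul_apply]
      refine (norm_sum_le _ _).trans (Finset.sum_le_sum fun b _ => ?_)
      rw [norm_mul]
      refine (mul_le_of_le_one_right (norm_nonneg _) (hle b i)).trans ?_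
      rw [Matrix.mul_apply]
      refine (norm_sum_le _ _).trans (Finset.sum_le_sum fun a _ => ?_)
      rw [norm_mul, conjTranspose_apply, norm_star, Matrix.sub_apply]
      exact mul_le_of_le_one_left (norm_nonneg _) (hle a i)
    rw [Finset.sum_comm]
    refine le_trans ?_ h5
    calc _ ≤ |(SignType.sign (l i) : ℝ) * ((Uᴴ * (B - A) * U) i i).re| := le_abs_self _
      _ = |(SignType.sign (l i) : ℝ)| * |((Uᴴ * (B - A) * U) i i).re| := abs_mul _ _
      _ ≤ 1 * ‖(Uᴴ * (B - A) * U) i i‖ :=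
          mul_le_mul (sign_abs_le _) (Complex.abs_re_le_norm _) (abs_nonneg _) zero_le_one
      _ = _ := one_mul _
  refine (Finset.sum_le_sum fun i _ => h4 i).trans ?_
  simp

lemma continuousOn_traceNorm {d : ℕ} (z : ℝ → Matrix (Fin d) (Fin d) ℂ) (S : Set ℝ)
    (hz : ∀ t ∈ S, ∀ i j, ContinuousAt (fun u => z u i j) t) (hh : ∀ t ∈ S, (z t).IsHermitian) :
    ContinuousOn (fun t => traceNorm (z t)) S := by
  intro t ht
  have hlim : Filter.Tendsto (fun u => (d : ℝ) * ∑ a, ∑ b, ‖z u a b - z t a b‖)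
      (nhdsWithin t S) (nhds 0) := by
    have hc : ContinuousAt (fun u => (d : ℝ) * ∑ a, ∑ b, ‖z u a b - z t a b‖) t := by
      refine ContinuousAt.mul continuousAt_const ?_
      refine tendsto_finsetSum _ fun a _ => tendsto_finsetSum _ fun b _ => ?_
      exact ((hz t ht a b).sub continuousAt_const).norm
    have := hc.tendsto
    simp only [sub_self, norm_zero, Finset.sum_const_zero, mul_zero] at this
    exact this.mono_left nhdsWithin_le_nhds
  rw [ContinuousWithinAt, tendsto_iff_norm_sub_tendsto_zero]
  refine squeeze_zero' (Filter.Eventually.of_forall fun u => norm_nonneg _) ?_ hlim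
  filter_upwards [self_mem_nhdsWithin] with u hu
  rw [Real.norm_eq_abs, abs_le]
  have h1 := traceNorm_sub_le (z t) (z u) (hh t ht) (hh u hu)
  have h2 := traceNorm_sub_le (z u) (z t) (hh u hu) (hh t ht)
  simp only [norm_sub_rev (z t _ _)] at h2
  exact ⟨by linarith, h1⟩

lemma core {d m : ℕ} (L : Fin m → Matrix (Fin d) (Fin d) ℂ) (c : ℝ)
    (hgap : ∀ U : Matrix (Fin d) (Fin d) ℂ, Uᴴ * U = 1 → ∀ i j,
      c ≤ ∑ k, ‖(Uᴴ * L k * U) i j‖ ^ 2 + ∑ k, ‖(Uᴴ * L k * U) j i‖ ^ 2)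
    (H : ℝ → Matrix (Fin d) (Fin d) ℂ) (s T : ℝ) (hsT : s ≤ T)
    (z : ℝ → Matrix (Fin d) (Fin d) ℂ) (hz : IsSolution (driven H L) s z)
    (hh : ∀ t, s ≤ t → (z t).IsHermitian) (htr : ∀ t, s ≤ t → (z t).trace = 0) :
    traceNorm (z T) ≤ Real.exp (-(c / (d + 1)) * (T - s)) * traceNorm (z s) := by
  set γ := c / ((d : ℝ) + 1) with hγ
  -- left Dini derivative bound
  have hleft : ∀ t, s ≤ t → ∃ (φ : ℝ → ℝ) (φ' : ℝ), HasDerivAt φ φ' t ∧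
      φ' ≤ -γ * traceNorm (z t) ∧ φ t = traceNorm (z t) ∧ ∀ u, s ≤ u → φ u ≤ traceNorm (z u) := by
    intro t ht
    obtain ⟨U, l, hU, hU', hzU, hN⟩ := exists_diag (z t) (hh t ht)
    have hback := diag_back U _ _ hU hzU
    refine ⟨_, _, hasDerivAt_conj U z _ t (hz t ht) (fun i => (SignType.sign (l i) : ℝ)),
      ?_, ?_, ?_⟩
    · rw [conj_driven U hU', hback, hN]
      simp only [diag_driven]
      refine classical_gap (fun i j => ∑ k, ‖(Uᴴ * L k * U) i j‖ ^ 2) c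
        (fun i j => Finset.sum_nonneg fun k _ => sq_nonneg _) (hgap U hU) l ?_
      have := htr t ht
      rw [hzU, trace_mul_comm, ← Matrix.mul_assoc, hU, Matrix.one_mul, trace_diagonal] at this
      exact_mod_cast this
    · simp only [hback, hN]
      simp [sign_mul_self]
    · intro u hu
      exact dual_le (z u) U (hh u hu) hU' _ fun i => sign_abs_le _
  have hcont := continuousOn_traceNorm z (Set.Ici s)
    (fun t ht i j => (hz t ht i j).continuousAt) hh
  have hG := le_gronwallBound_of_liminf_deriv_right_le
    (f := fun u => - traceNorm (z (T - u))) (f' := fun u => γ * (- traceNorm (z (T - u))))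
    (δ := - traceNorm (z T)) (K := γ) (ε := 0) (a := 0) (b := T - s)
    ?_ ?_ (by simp) (fun x _ => by simp) (T - s) ⟨by linarith, le_rfl⟩
  · rw [gronwallBound_ε0] at hG
    simp only [sub_sub_cancel, sub_zero] at hG
    have he : Real.exp (-γ * (T - s)) * Real.exp (γ * (T - s)) = 1 := by
      rw [← Real.exp_add]; simp
    have h1 : traceNorm (z T) * Real.exp (γ * (T - s)) ≤ traceNorm (z s) := by linarith
    calc traceNorm (z T) = Real.exp (-γ * (T - s)) *
          (traceNorm (z T) * Real.exp (γ * (T - s))) := by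
          linear_combination (- traceNorm (z T)) * he
      _ ≤ _ := mul_le_mul_of_nonneg_left h1 (Real.exp_pos _).le
  · refine (hcont.comp (by fun_prop) ?_).neg
    intro u hu
    simp only [Set.mem_Icc, Set.mem_Ici] at hu ⊢
    linarith [hu.2]
  · intro x hx r hr
    have hxs : s < T - x := by linarith [hx.2]
    obtain ⟨φ, φ', hφ, hφ', hφt, hφu⟩ := hleft (T - x) hxs.le
    have hψ : HasDerivAt (fun u => - φ (T - u)) φ' x := by
      have := (HasDerivAt.comp x hφ ((hasDerivAt_id x).const_sub T)).neg
      simpa using! this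
    have hlt : φ' < r := by
      refine lt_of_le_of_lt hφ' ?_
      simpa using hr
    have hev := (hψ.hasDerivWithinAt (s := Set.Ioi x)).limsup_slope_le' (lt_irrefl x) hlt
    apply Filter.Eventually.frequently
    filter_upwards [hev, Ioo_mem_nhdsGT hx.2] with u hu hux
    refine lt_of_le_of_lt ?_ hu
    rw [slope_def_field, div_eq_inv_mul]
    have := hφu (T - u) (by linarith [hux.2])
    apply mul_le_mul_of_nonneg_left _ (inv_nonneg.2 (by linarith [hux.1]))
    rw [hφt]; linarith

lemma trace_const {d m : ℕ} (L : Fin m → Matrix (Fin d) (Fin d) ℂ)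
    (H : ℝ → Matrix (Fin d) (Fin d) ℂ) (s : ℝ)
    (z : ℝ → Matrix (Fin d) (Fin d) ℂ) (hz : IsSolution (driven H L) s z) (t : ℝ) (ht : s ≤ t) :
    (z t).trace = (z s).trace := by
  have hd : ∀ u, s ≤ u → HasDerivAt (fun u => (z u).trace) 0 u := by
    intro u hu
    rw [← trace_driven H L u (z u)]
    exact HasDerivAt.fun_sum fun i _ => hz u hu i i
  exact constant_of_has_deriv_right_zero (f := fun u => (z u).trace) (a := s) (b := t)
    (fun u hu => (hd u hu.1).continuousAt.continuousWithinAt)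
    (fun u hu => (hd u hu.1).hasDerivWithinAt) t ⟨ht, le_rfl⟩

lemma eq_zero_of_traceNorm_le {d : ℕ} (A : Matrix (Fin d) (Fin d) ℂ) (hA : A.IsHermitian)
    (h : traceNorm A ≤ 0) : A = 0 := by
  obtain ⟨U, l, hU, hU', hAU, hN⟩ := exists_diag A hA
  have h0 : ∑ i, |l i| = 0 :=
    le_antisymm (hN ▸ h) (Finset.sum_nonneg fun i _ => abs_nonneg _)
  rw [Finset.sum_eq_zero_iff_of_nonneg fun i _ => abs_nonneg _] at h0
  have : l = 0 := funext fun i => abs_eq_zero.1 (h0 i (Finset.mem_univ i))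
  rw [hAU, this]; simp

lemma traceNorm_zero' {d : ℕ} : traceNorm (0 : Matrix (Fin d) (Fin d) ℂ) ≤ 0 := by
  obtain ⟨U, l, hU, hU', hAU, hN⟩ := exists_diag (0 : Matrix (Fin d) (Fin d) ℂ) (by simp)
  have := diag_back U _ _ hU hAU
  have hl : ∀ i, l i = 0 := fun i => by
    have := congrFun (congrFun this i) i
    simpa using this.symm
  rw [hN]; simp [hl]

/-- if `{L_j, L_j†}` spans all anti-Hermitian matrices as a complex vector
space, then the dissipator is Hamiltonian-independently contractive. -/
theorem antiHermitian_span_contractive {d m : ℕ} (L : Fin m → Matrix (Fin d) (Fin d) ℂ)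
    (hspan : ∀ X : Matrix (Fin d) (Fin d) ℂ, Xᴴ = -X →
      X ∈ Submodule.span ℂ (Set.range L ∪ Set.range fun j => (L j)ᴴ)) :
    HamIndepContractive L := by
  intro H hH
  obtain ⟨c, hc, hgap⟩ := gap_const L hspan
  refine ⟨1, c / (d + 1), one_pos, by positivity, ?_⟩
  intro s t _ hst ρ σ hρ hσ hρ0 hσ0
  rw [one_mul]
  have hx : IsSolution (driven H L) s (fun u => ρ u - σ u) := by
    intro u hu i j
    rw [driven_sub]
    exact (hρ u hu i j).sub (hσ u hu i j)
  have hxs : ((fun u => ρ u - σ u) s).IsHermitian := hρ0.1.isHermitian.sub hσ0.1.isHermitian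
  have hxt : ((fun u => ρ u - σ u) s).trace = 0 := by
    simp [trace_sub, hρ0.2, hσ0.2]
  change traceNorm ((fun u => ρ u - σ u) t) ≤ _ * traceNorm ((fun u => ρ u - σ u) s)
  generalize (fun u => ρ u - σ u) = x at hx hxs hxt
  -- the anti-Hermitian part is itself a solution, hence vanishes
  have hy : IsSolution (driven H L) s (fun u => Complex.I • (x u - (x u)ᴴ)) := by
    intro u hu i j
    rw [driven_smul, driven_sub, driven_star H hH.1]
    have h2 : HasDerivAt (fun u => (x u)ᴴ i j) ((driven H L u (x u))ᴴ i j) u := by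
      simp only [conjTranspose_apply]
      exact (hx u hu j i).star
    exact ((hx u hu i j).sub h2).const_mul Complex.I
  have hyh : ∀ u, (Complex.I • (x u - (x u)ᴴ)).IsHermitian := by
    intro u
    rw [Matrix.IsHermitian, conjTranspose_smul, conjTranspose_sub, conjTranspose_conjTranspose,
      RCLike.star_def, Complex.conj_I, neg_smul, ← smul_neg, neg_sub]
  have hys : Complex.I • (x s - (x s)ᴴ) = 0 := by rw [hxs.eq, sub_self, smul_zero]
  have hh : ∀ u, s ≤ u → (x u).IsHermitian := by
    intro u hu
    have h1 := core L c hgap H s u hu _ hy (fun u _ => hyh u) (fun u hu => by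
      rw [trace_const L H s _ hy u hu]
      simp only [hys, trace_zero])
    simp only [hys] at h1
    have h2 := eq_zero_of_traceNorm_le _ (hyh u) (h1.trans
      (mul_nonpos_of_nonneg_of_nonpos (Real.exp_pos _).le traceNorm_zero'))
    have h3 := (smul_eq_zero.1 h2).resolve_left Complex.I_ne_zero
    exact (sub_eq_zero.1 h3).symm
  exact core L c hgap H s t hst x hx hh
    (fun u hu => (trace_const L H s x hx u hu).trans hxt)

end Paper
end

section
/- For η > 0 and real α > 0, consider the three-level ladder dissipator D_{η,α} := η·D_{L_α} on M_3(ℂ) with single jump operator L_α := |0⟩⟨1| + α·|1⟩⟨2|, and define c_α := min{ (2 + α²)/4 − (α/4)·√(4 + α²), (1 + α²)/2 − √((1 − α² + α⁴)/3) }. Then the quantity μ₂ := sup{ ⟨x, Δ((D_{η,α} + D_{η,α}†)/2)(Δ x)⟩_HS : x Hermitian, tr x = 0, ‖x‖₂ = 1 } equals −c_α·η. Consequently, if α ∈ (√3 − √2, √3 + √2) then c_α > 0 and D_{η,α} is Hamiltonian-independently contractive with contraction rate at least c_α·η and constant K = √3. -/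
open scoped ComplexOrder Kronecker
open Matrix

namespace Paper

/-- `Δ(x) = x - (tr x / 3)·I` on `M₃(ℂ)`. -/
noncomputable def deltaOp3 (x : Matrix (Fin 3) (Fin 3) ℂ) : Matrix (Fin 3) (Fin 3) ℂ :=
  x - (x.trace / (3 : ℂ)) • (1 : Matrix (Fin 3) (Fin 3) ℂ)

/-- Hilbert–Schmidt inner product `⟨A, B⟩ = tr(A† B)`. -/
noncomputable def hsInner3 (A B : Matrix (Fin 3) (Fin 3) ℂ) : ℂ := (Aᴴ * B).trace

/-- Frobenius norm on `M₃(ℂ)`. -/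
noncomputable def frobNorm3 (A : Matrix (Fin 3) (Fin 3) ℂ) : ℝ :=
  Real.sqrt ((Aᴴ * A).trace.re)

/-- The ladder jump operator `L_α = |0⟩⟨1| + α|1⟩⟨2|`. -/
noncomputable def ladderJump (α : ℝ) : Matrix (Fin 3) (Fin 3) ℂ :=
  !![0, 1, 0; 0, 0, (α : ℂ); 0, 0, 0]

/-- The three-level ladder dissipator `D_{η,α} = η·D_{L_α}`. -/
noncomputable def ladderDissipator (η α : ℝ) (x : Matrix (Fin 3) (Fin 3) ℂ) :
    Matrix (Fin 3) (Fin 3) ℂ :=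
  (η : ℂ) • dissipator (ladderJump α) x

/-- The constant `c_α` of the three-level ladder dissipator. -/
noncomputable def ladderConst (α : ℝ) : ℝ :=
  min ((2 + α ^ 2) / 4 - (α / 4) * Real.sqrt (4 + α ^ 2))
      ((1 + α ^ 2) / 2 - Real.sqrt ((1 - α ^ 2 + α ^ 4) / 3))


lemma aux_off (α p q : ℝ) (hα : 0 < α) :
    2 * ((2 + α ^ 2) / 4 - (α / 4) * Real.sqrt (4 + α ^ 2)) * (p ^ 2 + q ^ 2)
      ≤ p ^ 2 + (1 + α ^ 2) * q ^ 2 - 2 * α * (p * q) := by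
  have hs : Real.sqrt (4 + α ^ 2) ^ 2 = 4 + α ^ 2 := Real.sq_sqrt (by positivity)
  have hm : 0 < Real.sqrt (4 + α ^ 2) - α := by
    rw [sub_pos]
    exact Real.lt_sqrt_of_sq_lt (by linarith)
  set s := Real.sqrt (4 + α ^ 2)
  have h : 0 ≤ (s - α) * ((s - α) * p ^ 2 + (s + α) * q ^ 2 - 4 * (p * q)) := by
    have : (s - α) * ((s - α) * p ^ 2 + (s + α) * q ^ 2 - 4 * (p * q))
        = ((s - α) * p - 2 * q) ^ 2 := by linear_combination q ^ 2 * hs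
    rw [this]; positivity
  have h2 := nonneg_of_mul_nonneg_right h hm
  nlinarith [mul_nonneg hα.le h2]

lemma aux_pos (u r : ℝ) (hr : 0 ≤ r) (h : r ^ 2 = (1 - u + u ^ 2) / 3) :
    0 < 1 - u + 2 * r := by
  by_contra hc
  push Not at hc
  nlinarith [sq_nonneg (u + 1), mul_nonneg hr hr]

lemma aux_diag (α b c : ℝ) :
    ((1 + α ^ 2) / 2 - Real.sqrt ((1 - α ^ 2 + α ^ 4) / 3)) * ((-b - c) ^ 2 + b ^ 2 + c ^ 2)
      ≤ b ^ 2 + α ^ 2 * c ^ 2 - (-b - c) * b - α ^ 2 * (b * c) := by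
  have hr : Real.sqrt ((1 - α ^ 2 + α ^ 4) / 3) ^ 2 = (1 - α ^ 2 + (α ^ 2) ^ 2) / 3 := by
    rw [Real.sq_sqrt]
    · ring
    · nlinarith [sq_nonneg (α ^ 2 - 1)]
  have h0 := Real.sqrt_nonneg ((1 - α ^ 2 + α ^ 4) / 3)
  set r := Real.sqrt ((1 - α ^ 2 + α ^ 4) / 3)
  generalize α ^ 2 = u at *
  have hA := aux_pos u r h0 hr
  have key : 0 ≤ (1 - u + 2 * r) * (b ^ 2 + u * c ^ 2 - (-b - c) * b - u * (b * c)
      - ((1 + u) / 2 - r) * ((-b - c) ^ 2 + b ^ 2 + c ^ 2)) := by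
    have : (1 - u + 2 * r) * (b ^ 2 + u * c ^ 2 - (-b - c) * b - u * (b * c)
      - ((1 + u) / 2 - r) * ((-b - c) ^ 2 + b ^ 2 + c ^ 2))
      = ((1 - u + 2 * r) * b + (r - u) * c) ^ 2 := by
      linear_combination 3 * c ^ 2 * hr
    rw [this]; positivity
  have := nonneg_of_mul_nonneg_right key hA
  linarith

lemma aux_corner (α : ℝ) :
    2 * ((1 + α ^ 2) / 2 - Real.sqrt ((1 - α ^ 2 + α ^ 4) / 3)) ≤ α ^ 2 := by
  have : 1 / 2 ≤ Real.sqrt ((1 - α ^ 2 + α ^ 4) / 3) := by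
    apply Real.le_sqrt_of_sq_le
    nlinarith [sq_nonneg (α ^ 2 - 1 / 2)]
  linarith

lemma const_pos (α : ℝ) (hα : 0 < α) (h1 : Real.sqrt 3 - Real.sqrt 2 < α)
    (h2 : α < Real.sqrt 3 + Real.sqrt 2) : 0 < ladderConst α := by
  unfold ladderConst
  apply lt_min
  · have hs : Real.sqrt (4 + α ^ 2) * α < 2 + α ^ 2 := by
      have hs : Real.sqrt (4 + α ^ 2) ^ 2 = 4 + α ^ 2 := Real.sq_sqrt (by positivity)
      have h0 := Real.sqrt_nonneg (4 + α ^ 2)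
      set s := Real.sqrt (4 + α ^ 2)
      apply lt_of_pow_lt_pow_left₀ 2 (by positivity)
      rw [mul_pow, hs]
      ring_nf
      linarith
    linarith
  · rw [sub_pos]
    rw [Real.sqrt_lt' (by positivity)]
    have h3 : Real.sqrt 3 ^ 2 = 3 := Real.sq_sqrt (by norm_num)
    have h4 : Real.sqrt 2 ^ 2 = 2 := Real.sq_sqrt (by norm_num)
    have h5 : 0 ≤ Real.sqrt 3 := Real.sqrt_nonneg 3
    have h6 : 0 ≤ Real.sqrt 2 := Real.sqrt_nonneg 2
    have hw : Real.sqrt 2 < Real.sqrt 3 := Real.sqrt_lt_sqrt (by norm_num) (by norm_num)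
    set a := Real.sqrt 3
    set b := Real.sqrt 2
    have e1 : (a - b) ^ 2 < α ^ 2 := by
      apply pow_lt_pow_left₀ h1 (by linarith) (by norm_num)
    have e2 : α ^ 2 < (a + b) ^ 2 := by
      apply pow_lt_pow_left₀ h2 hα.le (by norm_num)
    have e3 : (α ^ 2 - (a - b) ^ 2) * (α ^ 2 - (a + b) ^ 2) < 0 :=
      mul_neg_of_pos_of_neg (by linarith) (by linarith)
    have e4 : (α ^ 2 - (a - b) ^ 2) * (α ^ 2 - (a + b) ^ 2) = α ^ 4 - 10 * α ^ 2 + 1 := by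
      have : (a - b) ^ 2 * (a + b) ^ 2 = 1 := by
        have : (a - b) ^ 2 * (a + b) ^ 2 = (a ^ 2 - b ^ 2) ^ 2 := by ring
        rw [this, h3, h4]; norm_num
      linear_combination this - 2 * α ^ 2 * (h3 + h4)
    rw [e4] at e3
    nlinarith

lemma norm_formula (x : Matrix (Fin 3) (Fin 3) ℂ) :
    (xᴴ * x).trace.re = ∑ i, ∑ j, ((x i j).re ^ 2 + (x i j).im ^ 2) := by
  simp [Matrix.trace, Matrix.mul_apply, Fin.sum_univ_three]
  ring

lemma quad_formula (η α : ℝ) (x : Matrix (Fin 3) (Fin 3) ℂ) :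
    (hsInner3 x (ladderDissipator η α x)).re = η * (
      ((x 0 0).re * (x 1 1).re + (x 0 0).im * (x 1 1).im)
      + α ^ 2 * ((x 1 1).re * (x 2 2).re + (x 1 1).im * (x 2 2).im)
      - ((x 1 1).re ^ 2 + (x 1 1).im ^ 2) - α ^ 2 * ((x 2 2).re ^ 2 + (x 2 2).im ^ 2)
      + α * ((x 0 1).re * (x 1 2).re + (x 0 1).im * (x 1 2).im)
      + α * ((x 1 0).re * (x 2 1).re + (x 1 0).im * (x 2 1).im)
      - ((x 0 1).re ^ 2 + (x 0 1).im ^ 2) / 2 - ((x 1 0).re ^ 2 + (x 1 0).im ^ 2) / 2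
      - α ^ 2 / 2 * ((x 0 2).re ^ 2 + (x 0 2).im ^ 2)
      - α ^ 2 / 2 * ((x 2 0).re ^ 2 + (x 2 0).im ^ 2)
      - (1 + α ^ 2) / 2 * ((x 1 2).re ^ 2 + (x 1 2).im ^ 2)
      - (1 + α ^ 2) / 2 * ((x 2 1).re ^ 2 + (x 2 1).im ^ 2)) := by
  simp [hsInner3, ladderDissipator, dissipator, ladderJump, Matrix.trace, Matrix.mul_apply,
    Matrix.vecMul, dotProduct, Fin.sum_univ_three]
  ring

lemma quad_le (η α : ℝ) (hη : 0 < η) (hα : 0 < α) (x : Matrix (Fin 3) (Fin 3) ℂ)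
    (hx : x.trace = 0) :
    (hsInner3 x (ladderDissipator η α x)).re ≤ -(ladderConst α) * η * (xᴴ * x).trace.re := by
  rw [quad_formula, norm_formula]
  have ht : x 0 0 = - x 1 1 - x 2 2 := by
    simp only [Matrix.trace, Fin.sum_univ_three, Matrix.diag] at hx
    linear_combination hx
  have hre : (x 0 0).re = -(x 1 1).re - (x 2 2).re := by rw [ht]; simp
  have him : (x 0 0).im = -(x 1 1).im - (x 2 2).im := by rw [ht]; simp
  have hc1 : ladderConst α ≤ _ := min_le_left _ _
  have hc2 : ladderConst α ≤ _ := min_le_right _ _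
  have off : ∀ p q : ℝ, 2 * ladderConst α * (p ^ 2 + q ^ 2)
      ≤ p ^ 2 + (1 + α ^ 2) * q ^ 2 - 2 * α * (p * q) := fun p q =>
    le_trans (by gcongr) (aux_off α p q hα)
  have dia : ∀ b c : ℝ, ladderConst α * ((-b - c) ^ 2 + b ^ 2 + c ^ 2)
      ≤ b ^ 2 + α ^ 2 * c ^ 2 - (-b - c) * b - α ^ 2 * (b * c) := fun b c =>
    le_trans (by gcongr) (aux_diag α b c)
  have cor : ∀ b : ℝ, 2 * ladderConst α * b ^ 2 ≤ α ^ 2 * b ^ 2 := fun b => by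
    have := aux_corner α
    gcongr
    linarith
  have o1 := off (x 0 1).re (x 1 2).re
  have o2 := off (x 0 1).im (x 1 2).im
  have o3 := off (x 1 0).re (x 2 1).re
  have o4 := off (x 1 0).im (x 2 1).im
  have d1 := dia (x 1 1).re (x 2 2).re
  have d2 := dia (x 1 1).im (x 2 2).im
  have c1 := cor (x 0 2).re
  have c2 := cor (x 0 2).im
  have c3 := cor (x 2 0).re
  have c4 := cor (x 2 0).im
  rw [show ∀ N, -(ladderConst α) * η * N = η * (-(ladderConst α) * N) from fun N => by ring]
  apply mul_le_mul_of_nonneg_left _ hη.le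
  simp only [Fin.sum_univ_three, hre, him]
  linarith

lemma trace_diss (η α : ℝ) (x : Matrix (Fin 3) (Fin 3) ℂ) :
    (ladderDissipator η α x).trace = 0 := by
  simp [ladderDissipator, dissipator, ladderJump, Matrix.trace, Matrix.mul_apply,
    Matrix.vecMul, dotProduct, Fin.sum_univ_three]
  ring

lemma trace_ham (H x : Matrix (Fin 3) (Fin 3) ℂ) : (hamTerm H x).trace = 0 := by
  simp [hamTerm, Matrix.trace_mul_comm H x]

lemma ham_re (H x : Matrix (Fin 3) (Fin 3) ℂ) (hH : H.IsHermitian) :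
    (hsInner3 x (hamTerm H x)).re = 0 := by
  have h1 : star ((xᴴ * (H * x)).trace) = (xᴴ * (H * x)).trace := by
    rw [← Matrix.trace_conjTranspose]
    simp [Matrix.conjTranspose_mul, hH.eq, Matrix.mul_assoc]
  have h2 : star ((xᴴ * (x * H)).trace) = (xᴴ * (x * H)).trace := by
    rw [← Matrix.trace_conjTranspose]
    simp only [Matrix.conjTranspose_mul, hH.eq, Matrix.conjTranspose_conjTranspose]
    rw [Matrix.mul_assoc, Matrix.trace_mul_comm, Matrix.mul_assoc]
  have i1 : ((xᴴ * (H * x)).trace).im = 0 := Complex.conj_eq_iff_im.mp h1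
  have i2 : ((xᴴ * (x * H)).trace).im = 0 := Complex.conj_eq_iff_im.mp h2
  simp [hsInner3, hamTerm, Matrix.mul_sub, i1, i2]

lemma traceNorm_facts (A : Matrix (Fin 3) (Fin 3) ℂ) :
    traceNorm A ≤ Real.sqrt 3 * frobNorm3 A ∧ frobNorm3 A ≤ traceNorm A := by
  unfold traceNorm frobNorm3
  have hP := Matrix.posSemidef_conjTranspose_mul_self A
  have htr : (Aᴴ * A).trace.re = ∑ i, hP.isHermitian.eigenvalues i := by
    rw [hP.isHermitian.trace_eq_sum_eigenvalues]; simp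
  have hnn := hP.eigenvalues_nonneg
  rw [htr]
  generalize hP.isHermitian.eigenvalues = e at *
  constructor
  · rw [← Real.sqrt_mul (by norm_num)]
    apply Real.le_sqrt_of_sq_le
    have := sq_sum_le_card_mul_sum_sq (s := Finset.univ) (f := fun i => Real.sqrt (e i))
    simpa [Real.sq_sqrt (hnn _)] using this
  · have hs : 0 ≤ ∑ i, Real.sqrt (e i) := Finset.sum_nonneg fun i _ => Real.sqrt_nonneg _
    apply Real.sqrt_le_iff.2 ⟨hs, ?_⟩
    have := Finset.sum_sq_le_sq_sum_of_nonneg (s := Finset.univ) (f := fun i => Real.sqrt (e i))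
      (fun i _ => Real.sqrt_nonneg _)
    simpa [Real.sq_sqrt (hnn _)] using this

lemma form_eq (η α : ℝ)
    (Dadj : Matrix (Fin 3) (Fin 3) ℂ → Matrix (Fin 3) (Fin 3) ℂ)
    (hadj : ∀ A B : Matrix (Fin 3) (Fin 3) ℂ,
      hsInner3 A (ladderDissipator η α B) = hsInner3 (Dadj A) B)
    (x : Matrix (Fin 3) (Fin 3) ℂ) (hx : x.trace = 0) :
    (hsInner3 x (deltaOp3 (((1 : ℂ)/2) •
        (ladderDissipator η α (deltaOp3 x) + Dadj (deltaOp3 x))))).re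
      = (hsInner3 x (ladderDissipator η α x)).re := by
  have h0 : deltaOp3 x = x := by simp [deltaOp3, hx]
  have h1 : ∀ y, hsInner3 x (deltaOp3 y) = hsInner3 x y := fun y => by
    simp [hsInner3, deltaOp3, Matrix.mul_sub, Matrix.trace_conjTranspose, hx]
  have h2 : hsInner3 x (Dadj x) = star (hsInner3 x (ladderDissipator η α x)) := by
    rw [hadj]
    simp only [hsInner3]
    rw [← Matrix.trace_conjTranspose]
    simp [Matrix.conjTranspose_mul]
  have h3 : hsInner3 x (((1 : ℂ)/2) • (ladderDissipator η α x + Dadj x))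
      = ((1 : ℂ)/2) * (hsInner3 x (ladderDissipator η α x) + hsInner3 x (Dadj x)) := by
    simp [hsInner3, Matrix.mul_add, Matrix.trace_add, Matrix.trace_smul]
    ring
  rw [h1, h0, h3, h2]
  simp
  ring

lemma attain_of (η α : ℝ) (y : Matrix (Fin 3) (Fin 3) ℂ) (hy : y.IsHermitian)
    (ht : y.trace = 0) (hpos : 0 < (yᴴ * y).trace.re)
    (hq : (hsInner3 y (ladderDissipator η α y)).re = -(ladderConst α) * η * (yᴴ * y).trace.re) :
    ∃ x : Matrix (Fin 3) (Fin 3) ℂ, x.IsHermitian ∧ x.trace = 0 ∧ frobNorm3 x = 1 ∧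
      (hsInner3 x (ladderDissipator η α x)).re = -(ladderConst α) * η := by
  set N := (yᴴ * y).trace.re with hN
  set k : ℝ := (Real.sqrt N)⁻¹ with hk
  have hk2 : k ^ 2 * N = 1 := by
    rw [hk, inv_pow, Real.sq_sqrt hpos.le, inv_mul_cancel₀ hpos.ne']
  refine ⟨(k : ℂ) • y, ?_, by simp [ht], ?_, ?_⟩
  · unfold Matrix.IsHermitian
    rw [Matrix.conjTranspose_smul, hy.eq]; simp
  · unfold frobNorm3
    rw [Real.sqrt_eq_one, ← hk2, hN, norm_formula, norm_formula]
    simp [Fin.sum_univ_three]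
    ring
  · have : (hsInner3 ((k : ℂ) • y) (ladderDissipator η α ((k : ℂ) • y))).re
        = k ^ 2 * (hsInner3 y (ladderDissipator η α y)).re := by
      rw [quad_formula, quad_formula]
      simp
      ring
    rw [this, hq]
    linear_combination (-(ladderConst α) * η) * hk2

lemma attain (η α : ℝ) (hα : 0 < α) :
    ∃ x : Matrix (Fin 3) (Fin 3) ℂ, x.IsHermitian ∧ x.trace = 0 ∧ frobNorm3 x = 1 ∧
      (hsInner3 x (ladderDissipator η α x)).re = -(ladderConst α) * η := by
  rcases min_choice ((2 + α ^ 2) / 4 - (α / 4) * Real.sqrt (4 + α ^ 2))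
      ((1 + α ^ 2) / 2 - Real.sqrt ((1 - α ^ 2 + α ^ 4) / 3)) with h | h
  · have hs : Real.sqrt (4 + α ^ 2) ^ 2 = 4 + α ^ 2 := Real.sq_sqrt (by positivity)
    have hc : ladderConst α = _ := h
    set s := Real.sqrt (4 + α ^ 2)
    apply attain_of η α !![0, 2, 0; 2, 0, ((s - α : ℝ) : ℂ); 0, ((s - α : ℝ) : ℂ), 0]
    · ext i j; fin_cases i <;> fin_cases j <;> simp
    · simp [Matrix.trace, Fin.sum_univ_three]
    · rw [norm_formula]; simp [Fin.sum_univ_three]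
      positivity
    · rw [norm_formula, quad_formula, hc]
      simp [Fin.sum_univ_three]
      linear_combination (-η * α / 2 * (s - α)) * hs
  · have hr : Real.sqrt ((1 - α ^ 2 + α ^ 4) / 3) ^ 2 = (1 - α ^ 2 + α ^ 4) / 3 := by
      rw [Real.sq_sqrt]
      nlinarith [sq_nonneg (α ^ 2 - 1)]
    have h0 := Real.sqrt_nonneg ((1 - α ^ 2 + α ^ 4) / 3)
    have hc : ladderConst α = _ := h
    set r := Real.sqrt ((1 - α ^ 2 + α ^ 4) / 3)
    have hA := aux_pos (α ^ 2) r h0 (by rw [hr]; ring)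
    apply attain_of η α (Matrix.diagonal ![((-(α ^ 2 - r) - (1 - α ^ 2 + 2 * r) : ℝ) : ℂ),
      ((α ^ 2 - r : ℝ) : ℂ), ((1 - α ^ 2 + 2 * r : ℝ) : ℂ)])
    · ext i j; fin_cases i <;> fin_cases j <;> simp
    · simp [Matrix.trace, Fin.sum_univ_three]
      ring
    · rw [norm_formula]
      simp only [Fin.sum_univ_three]
      have : 0 < (1 - α ^ 2 + 2 * r) ^ 2 := by positivity
      simp [← Complex.ofReal_pow, -Complex.ofReal_sub, -Complex.ofReal_add, -Complex.ofReal_mul, -Complex.ofReal_neg]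
      positivity
    · rw [norm_formula, quad_formula, hc]
      simp [Fin.sum_univ_three, ← Complex.ofReal_pow]
      linear_combination (-3 * η * (1 - α ^ 2 + 2 * r)) * hr

lemma decay (η α : ℝ) (hη : 0 < η) (hα : 0 < α) (H : ℝ → Matrix (Fin 3) (Fin 3) ℂ)
    (hH : IsHamiltonianFamily H) (s t : ℝ) (hst : s ≤ t) (x : ℝ → Matrix (Fin 3) (Fin 3) ℂ)
    (hx : IsSolution (fun u x => hamTerm (H u) x + ladderDissipator η α x) s x)
    (h0 : (x s).trace = 0) :
    frobNorm3 (x t) ≤ Real.exp (-(ladderConst α * η) * (t - s)) * frobNorm3 (x s) := by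
  have htr : ∀ u, s ≤ u → (x u).trace = 0 := by
    have hd : ∀ u, s ≤ u → HasDerivAt (fun v => (x v).trace) 0 u := fun u hu => by
      have h := (((hx u hu) 0 0).add ((hx u hu) 1 1)).add ((hx u hu) 2 2)
      have e : (hamTerm (H u) (x u) + ladderDissipator η α (x u)).trace = 0 := by
        rw [Matrix.trace_add, trace_ham, trace_diss, add_zero]
      simp only [Matrix.trace, Fin.sum_univ_three, Matrix.diag] at e ⊢
      rw [e] at h
      exact h
    intro u hu
    rw [← h0]
    apply constant_of_has_deriv_right_zero (a := s) (b := u)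
      (fun v hv => (hd v hv.1).continuousAt.continuousWithinAt)
      (fun v hv => (hd v hv.1).hasDerivWithinAt) u ⟨hu, le_rfl⟩
  set c := ladderConst α * η with hc
  have hN : ∀ u, s ≤ u → HasDerivAt (fun v => ((x v)ᴴ * x v).trace.re)
      (2 * (hsInner3 (x u) (hamTerm (H u) (x u) + ladderDissipator η α (x u))).re) u := by
    intro u hu
    have hre : ∀ i j, HasDerivAt (fun v => (x v i j).re ^ 2 + (x v i j).im ^ 2)
      (2 * ((x u i j).re * ((hamTerm (H u) (x u) + ladderDissipator η α (x u)) i j).re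
        + (x u i j).im * ((hamTerm (H u) (x u) + ladderDissipator η α (x u)) i j).im)) u := by
      intro i j
      have h := hx u hu i j
      have hr := (Complex.reCLM.hasFDerivAt.comp_hasDerivAt u h).pow 2
      have hi := (Complex.imCLM.hasFDerivAt.comp_hasDerivAt u h).pow 2
      refine (hr.add hi).congr_deriv ?_
      simp
      ring
    have := HasDerivAt.fun_sum (u := Finset.univ) fun i _ =>
      HasDerivAt.fun_sum (u := Finset.univ) fun j _ => hre i j
    simp only [norm_formula]
    refine this.congr_deriv ?_
    generalize hamTerm (H u) (x u) + ladderDissipator η α (x u) = y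
    simp [hsInner3, Matrix.trace, Matrix.mul_apply, Fin.sum_univ_three]
    ring
  have hle : ∀ u, s ≤ u →
      2 * (hsInner3 (x u) (hamTerm (H u) (x u) + ladderDissipator η α (x u))).re
        ≤ -2 * c * ((x u)ᴴ * x u).trace.re := fun u hu => by
    have e : hsInner3 (x u) (hamTerm (H u) (x u) + ladderDissipator η α (x u))
      = hsInner3 (x u) (hamTerm (H u) (x u)) + hsInner3 (x u) (ladderDissipator η α (x u)) := by
      simp [hsInner3, Matrix.mul_add]
    rw [e, Complex.add_re, ham_re _ _ (hH.1 u)]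
    have := quad_le η α hη hα (x u) (htr u hu)
    rw [hc]
    linarith
  have hg : ∀ u, s ≤ u → HasDerivAt
      (fun v => Real.exp (2 * c * v) * ((x v)ᴴ * x v).trace.re)
      (Real.exp (2 * c * u) * (2 * c) * ((x u)ᴴ * x u).trace.re + Real.exp (2 * c * u) *
      (2 * (hsInner3 (x u) (hamTerm (H u) (x u) + ladderDissipator η α (x u))).re)) u := by
    intro u hu
    have h1 : HasDerivAt (fun v => Real.exp (2 * c * v)) (Real.exp (2 * c * u) * (2 * c)) u := by
      have := ((hasDerivAt_id u).const_mul (2 * c)).exp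
      simpa using this
    exact h1.mul (hN u hu)
  have hanti : AntitoneOn (fun v => Real.exp (2 * c * v) * ((x v)ᴴ * x v).trace.re)
      (Set.Ici s) := by
    apply antitoneOn_of_deriv_nonpos (convex_Ici s)
    · exact fun u hu => (hg u hu).continuousAt.continuousWithinAt
    · intro u hu
      rw [interior_Ici] at hu
      exact (hg u hu.le).differentiableAt.differentiableWithinAt
    · intro u hu
      rw [interior_Ici] at hu
      rw [(hg u hu.le).deriv]
      have := mul_le_mul_of_nonneg_left (hle u hu.le) (Real.exp_pos (2 * c * u)).le
      linarith
  have hfin := hanti (Set.mem_Ici.2 le_rfl) (Set.mem_Ici.2 hst) hst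
  simp only at hfin
  unfold frobNorm3
  apply Real.sqrt_le_iff.2 ⟨by positivity, ?_⟩
  have hnn : 0 ≤ ((x s)ᴴ * x s).trace.re := by
    rw [norm_formula]; positivity
  rw [mul_pow, Real.sq_sqrt hnn]
  have e1 : Real.exp (-c * (t - s)) ^ 2 = Real.exp (2 * c * s) / Real.exp (2 * c * t) := by
    rw [← Real.exp_sub, ← Real.exp_nat_mul]
    congr 1
    push_cast
    ring
  rw [e1, div_mul_eq_mul_div, le_div_iff₀ (Real.exp_pos _)]
  linarith

/-- for the three-level ladder dissipator `D_{η,α}`,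
the quantity `μ₂` equals `-c_α·η`; consequently for `α ∈ (√3-√2, √3+√2)` the dissipator
is Hamiltonian-independently contractive with rate at least `c_α·η` and constant `√3`. -/
theorem ladder_dissipator_contractive (η α : ℝ) (hη : 0 < η) (hα : 0 < α)
    (Dadj : Matrix (Fin 3) (Fin 3) ℂ → Matrix (Fin 3) (Fin 3) ℂ)
    -- `Dadj` is the adjoint of `D_{η,α}` w.r.t. the HS inner product:
    (hadj : ∀ A B : Matrix (Fin 3) (Fin 3) ℂ,
      hsInner3 A (ladderDissipator η α B) = hsInner3 (Dadj A) B)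
    (μ2 : ℝ)
    (hμ2 : μ2 = sSup { r : ℝ | ∃ x : Matrix (Fin 3) (Fin 3) ℂ,
      x.IsHermitian ∧ x.trace = 0 ∧ frobNorm3 x = 1 ∧
      r = (hsInner3 x (deltaOp3 (((1 : ℂ)/2) •
        (ladderDissipator η α (deltaOp3 x) + Dadj (deltaOp3 x))))).re }) :
    μ2 = -(ladderConst α) * η ∧
    (Real.sqrt 3 - Real.sqrt 2 < α ∧ α < Real.sqrt 3 + Real.sqrt 2 →
      0 < ladderConst α ∧
      ∀ H : ℝ → Matrix (Fin 3) (Fin 3) ℂ, IsHamiltonianFamily H →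
        ∀ s t : ℝ, 0 ≤ s → s ≤ t → ∀ ρ σ : ℝ → Matrix (Fin 3) (Fin 3) ℂ,
          IsSolution (fun u x => hamTerm (H u) x + ladderDissipator η α x) s ρ →
          IsSolution (fun u x => hamTerm (H u) x + ladderDissipator η α x) s σ →
          IsDensity (ρ s) → IsDensity (σ s) →
          traceNorm (ρ t - σ t) ≤
            Real.sqrt 3 * Real.exp (-(ladderConst α * η) * (t - s)) *
              traceNorm (ρ s - σ s)) := by
  constructor
  · obtain ⟨x, hx1, hx2, hx3, hx4⟩ := attain η α hα
    rw [hμ2]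
    apply IsGreatest.csSup_eq
    refine ⟨⟨x, hx1, hx2, hx3, ?_⟩, ?_⟩
    · rw [form_eq η α Dadj hadj x hx2, hx4]
    · rintro r ⟨y, -, hy2, hy3, rfl⟩
      rw [form_eq η α Dadj hadj y hy2]
      have h := quad_le η α hη hα y hy2
      rw [frobNorm3, Real.sqrt_eq_one] at hy3
      rwa [hy3, mul_one] at h
  · rintro ⟨h1, h2⟩
    refine ⟨const_pos α hα h1 h2, ?_⟩
    intro H hH s t _ hst ρ σ hρ hσ dρ dσ
    have hsol : IsSolution (fun u x => hamTerm (H u) x + ladderDissipator η α x) s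
        (fun u => ρ u - σ u) := by
      intro u hu i j
      have h := (hρ u hu i j).sub (hσ u hu i j)
      have e : hamTerm (H u) (ρ u - σ u) + ladderDissipator η α (ρ u - σ u)
        = (hamTerm (H u) (ρ u) + ladderDissipator η α (ρ u))
          - (hamTerm (H u) (σ u) + ladderDissipator η α (σ u)) := by
        simp only [hamTerm, ladderDissipator, dissipator, Matrix.mul_sub, Matrix.sub_mul,
          smul_sub, smul_add]
        abel
      simp only [e]
      exact h
    have hd := decay η α hη hα H hH s t hst _ hsol (by
      simp [Matrix.trace_sub, dρ.2, dσ.2])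
    calc traceNorm (ρ t - σ t) ≤ Real.sqrt 3 * frobNorm3 (ρ t - σ t) := (traceNorm_facts _).1
      _ ≤ Real.sqrt 3 * (Real.exp (-(ladderConst α * η) * (t - s)) * frobNorm3 (ρ s - σ s)) := by
          gcongr
      _ ≤ Real.sqrt 3 * (Real.exp (-(ladderConst α * η) * (t - s)) * traceNorm (ρ s - σ s)) := by
          gcongr
          exact (traceNorm_facts _).2
      _ = _ := by ring

end Paper
end
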